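/- Let T^{ab} be a smooth symmetric tensor field on ℝ⁴ with trace T = η_{ab} T^{ab}, and define the current J^{abc} = T^{c[a,b]} − (1/3) η^{c[a} T^{,b]}. Then the trace of the current over its last two indices satisfies η_{bc} J^{abc} = (1/2) ∂_b T^{ab}. In particular, if J^{abc} = ∂_d C^{abcd} for some smooth tensor field C^{abcd} that is trace-free in the sense η_{bc} C^{abcd} = 0, then T is conserved: ∂_b T^{ab} = 0. -/

import Mathlib

noncomputable section

/-- Points of flat spacetime ℝ⁴. -/
abbrev Spacetime : Type := Fin 4 → ℝ

/-- A scalar field on spacetime. -/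
abbrev ScalarField : Type := Spacetime → ℝ

/-- The Minkowski metric η = diag(1, -1, -1, -1); numerically equal to its inverse η^{ab}. -/
def η (a b : Fin 4) : ℝ := if a = b then (if a = 0 then 1 else -1) else 0

/-- The partial derivative ∂ₐ of a scalar field. -/
def pd (a : Fin 4) (f : ScalarField) : ScalarField := fun x => fderiv ℝ f x (Pi.single a 1)

/-- The trace h = η^{ab} h_{ab}. -/
def trh (h : Fin 4 → Fin 4 → ScalarField) : ScalarField := fun x => ∑ a, ∑ b, η a b * h a b x

/-- The linearized Lanczos potential
L_{abc} = (1/2)(h_{c[a,b]} - (1/6) η_{c[a} h_{,b]}). -/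
def Lanc (h : Fin 4 → Fin 4 → ScalarField) (a b c : Fin 4) : ScalarField := fun x =>
  (1/2) * ((1/2) * (pd b (h c a) x - pd a (h c b) x)
    - (1/6) * ((1/2) * (η c a * pd b (trh h) x - η c b * pd a (trh h) x)))

/-- The linearized Riemann tensor
R_{abcd}[h] = (1/2)(∂_b ∂_c h_{ad} + ∂_a ∂_d h_{bc} - ∂_a ∂_c h_{bd} - ∂_b ∂_d h_{ac}). -/
def Riem (h : Fin 4 → Fin 4 → ScalarField) (a b c d : Fin 4) : ScalarField := fun x =>
  (1/2) * (pd b (pd c (h a d)) x + pd a (pd d (h b c)) x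
    - pd a (pd c (h b d)) x - pd b (pd d (h a c)) x)

/-- The linearized Ricci tensor R_{ab}[h] = η^{cd} R_{acbd}[h]. -/
def Ric (h : Fin 4 → Fin 4 → ScalarField) (a b : Fin 4) : ScalarField := fun x =>
  ∑ c, ∑ d, η c d * Riem h a c b d x

/-- The linearized Ricci scalar R[h] = η^{ab} R_{ab}[h]. -/
def RS (h : Fin 4 → Fin 4 → ScalarField) : ScalarField := fun x => ∑ a, ∑ b, η a b * Ric h a b x

/-- The linearized Weyl tensor
C_{abcd}[h] = R_{abcd} - (η_{a[c} R_{d]b} - η_{b[c} R_{d]a}) + (R/3) η_{a[c} η_{d]b}. -/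
def Weyl (h : Fin 4 → Fin 4 → ScalarField) (a b c d : Fin 4) : ScalarField := fun x =>
  Riem h a b c d x
    - ((1/2) * (η a c * Ric h d b x - η a d * Ric h c b x)
      - (1/2) * (η b c * Ric h d a x - η b d * Ric h c a x))
    + (RS h x / 3) * ((1/2) * (η a c * η d b - η a d * η c b))

/-- L_{ab} = ∂^c L_{acb} - ∂_b (η^{cd} L_{acd}). -/
def Ldn (L : Fin 4 → Fin 4 → Fin 4 → ScalarField) (a b : Fin 4) : ScalarField := fun x =>
  (∑ c, ∑ d, η c d * pd d (L a c b) x)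
    - pd b (fun y => ∑ c, ∑ d, η c d * L a c d y) x

/-- L = η^{ab} L_{ab}. -/
def Ltr (L : Fin 4 → Fin 4 → Fin 4 → ScalarField) : ScalarField := fun x => ∑ a, ∑ b, η a b * Ldn L a b x

/-- The linearized Weyl–Lanczos formula:
C_{abcd}[L] = 2 L_{ab[c,d]} + 2 L_{cd[a,b]} - η_{a[c}(L_{|b|d]} + L_{d]b})
  + η_{b[c}(L_{|a|d]} + L_{d]a}) + (2L/3) η_{a[c} η_{d]b}. -/
def WL (L : Fin 4 → Fin 4 → Fin 4 → ScalarField) (a b c d : Fin 4) : ScalarField := fun x =>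
  2 * ((1/2) * (pd d (L a b c) x - pd c (L a b d) x))
    + 2 * ((1/2) * (pd b (L c d a) x - pd a (L c d b) x))
    - (1/2) * (η a c * (Ldn L b d x + Ldn L d b x) - η a d * (Ldn L b c x + Ldn L c b x))
    + (1/2) * (η b c * (Ldn L a d x + Ldn L d a x) - η b d * (Ldn L a c x + Ldn L c a x))
    + (2 * Ltr L x / 3) * ((1/2) * (η a c * η d b - η a d * η c b))

/-- Partial differentiation commutes with the metric contraction of a differentiable tensor. -/
theorem pd_sum_η_mul {F : Fin 4 → Fin 4 → ScalarField} (hF : ∀ i j, Differentiable ℝ (F i j))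
    (e : Fin 4) (x : Spacetime) :
    pd e (fun y => ∑ i, ∑ j, η i j * F i j y) x = ∑ i, ∑ j, η i j * pd e (F i j) x := by
  have h : HasFDerivAt (fun y => ∑ i, ∑ j, η i j * F i j y)
      (∑ i, ∑ j, η i j • fderiv ℝ (F i j) x) x :=
    HasFDerivAt.fun_sum fun i _ => HasFDerivAt.fun_sum fun j _ =>
      ((hF i j x).hasFDerivAt).const_mul (η i j)
  simp [pd, h.fderiv]

/-- For a smooth symmetric tensor field T^{ab} with trace T = η_{ab} T^{ab}
and current J^{abc} = T^{c[a,b]} - (1/3) η^{c[a} T^{,b]}, the trace of the current over its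
last two indices satisfies η_{bc} J^{abc} = (1/2) ∂_b T^{ab}; in particular, if
J^{abc} = ∂_d C^{abcd} with C trace-free in the sense η_{bc} C^{abcd} = 0, then
∂_b T^{ab} = 0. -/
theorem current_trace_and_conservation
    (T : Fin 4 → Fin 4 → ScalarField)
    (hsmooth : ∀ a b, ContDiff ℝ (⊤ : ℕ∞) (T a b))
    (hsym : ∀ a b, T a b = T b a)
    (J : Fin 4 → Fin 4 → Fin 4 → ScalarField)
    (hJ : ∀ a b c, ∀ x : Spacetime, J a b c x =
      (1/2) * ((∑ e, η b e * pd e (T c a) x) - (∑ e, η a e * pd e (T c b) x))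
      - (1/3) * ((1/2) * (η c a * (∑ e, η b e * pd e (fun y => ∑ i, ∑ j, η i j * T i j y) x)
        - η c b * (∑ e, η a e * pd e (fun y => ∑ i, ∑ j, η i j * T i j y) x)))) :
    (∀ a, ∀ x : Spacetime, (∑ b, ∑ c, η b c * J a b c x) = (1/2) * ∑ b, pd b (T a b) x) ∧
    (∀ C : Fin 4 → Fin 4 → Fin 4 → Fin 4 → ScalarField,
      (∀ a b c d, ContDiff ℝ (⊤ : ℕ∞) (C a b c d)) →
      (∀ a d, ∀ x : Spacetime, (∑ b, ∑ c, η b c * C a b c d x) = 0) →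
      (∀ a b c, ∀ x : Spacetime, J a b c x = ∑ d, pd d (C a b c d) x) →
      ∀ a, ∀ x : Spacetime, (∑ b, pd b (T a b) x) = 0) := by
  have htrace : ∀ a, ∀ x : Spacetime,
      (∑ b, ∑ c, η b c * J a b c x) = (1/2) * ∑ b, pd b (T a b) x := by
    intro a x
    simp only [hJ, pd_sum_η_mul fun i j => (hsmooth i j).differentiable (by simp), hsym a]
    fin_cases a <;> simp [Fin.sum_univ_four, η] <;> ring
  refine ⟨htrace, fun C hC htr hJC a x => ?_⟩
  have hzero : (∑ b, ∑ c, η b c * J a b c x) = 0 := by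
    calc (∑ b, ∑ c, η b c * J a b c x)
        = ∑ d, ∑ b, ∑ c, η b c * pd d (C a b c d) x := by
          simp only [hJC, Fin.sum_univ_four]
          ring
      _ = ∑ d, pd d (fun y => ∑ b, ∑ c, η b c * C a b c d y) x := by
          refine Finset.sum_congr rfl fun d _ => ?_
          rw [pd_sum_η_mul fun b c => (hC a b c d).differentiable (by simp)]
      _ = 0 := by simp [htr, pd]
  linarith [htrace a x]
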